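/- (Theorem: algorithm for model BC-X.) Let A_t ∈ ℝ^{M×N} be nonnegative for t = 1,…,T, Y ∈ ℝ^{M×T} nonnegative, α > 0, λ_B, μ_B, λ_C, μ_C, λ_X, μ_X, τ ≥ 0, and let TV, P, Z be as defined with ε_TV > 0 and nonempty neighbourhood sets. Define F(B,C,X) := Σ_{t=1}^T (1/2)‖A_t X_{•,t} − Y_{•,t}‖₂² + (α/2)‖BC − X‖_F² + λ_B‖B‖₁ + (μ_B/2)‖B‖_F² + λ_C‖C‖₁ + (μ_C/2)‖C‖_F² + λ_X‖X‖₁ + (μ_X/2)‖X‖_F² + (τ/2)TV(B). Given strictly positive X^{[d]} ∈ ℝ^{N×T}, B^{[d]} ∈ ℝ^{N×K}, C^{[d]} ∈ ℝ^{K×T}, define sequentially: X^{[d+1]}_{•,t} := X^{[d]}_{•,t} ∘ (A_tᵀY_{•,t} + αB^{[d]}C^{[d]}_{•,t}) ⊘ (A_tᵀA_tX^{[d]}_{•,t} + (μ_X + α)X^{[d]}_{•,t} + λ_X𝟙_{N×1}); B^{[d+1]} := B^{[d]} ∘ (αX^{[d+1]}(C^{[d]})ᵀ + τP(B^{[d]})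 ∘ Z(B^{[d]})) ⊘ (αB^{[d]}C^{[d]}(C^{[d]})ᵀ + μ_B B^{[d]} + λ_B𝟙_{N×K} + τB^{[d]} ∘ P(B^{[d]})); C^{[d+1]} := C^{[d]} ∘ (α(B^{[d+1]})ᵀX^{[d+1]}) ⊘ (α(B^{[d+1]})ᵀB^{[d+1]}C^{[d]} + μ_C C^{[d]} + λ_C𝟙_{K×T}). Then F(B^{[d+1]}, C^{[d+1]}, X^{[d+1]}) ≤ F(B^{[d]}, C^{[d]}, X^{[d]}). -/

import Mathlib

open Matrix BigOperators

/-- `|∇_{nk}B| = sqrt(ε² + Σ_{ℓ∈𝒩_n}(B_{nk} − B_{ℓk})²)`. -/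
noncomputable def gradAbs (N K : ℕ) (ε : ℝ) (nbr : Fin N → Finset (Fin N))
    (B : Matrix (Fin N) (Fin K) ℝ) (n : Fin N) (k : Fin K) : ℝ :=
  Real.sqrt (ε ^ 2 + ∑ ℓ ∈ nbr n, (B n k - B ℓ k) ^ 2)

/-- The smoothed isotropic total variation `TV(B) = Σ_k Σ_n |∇_{nk}B|`. -/
noncomputable def smoothTV (N K : ℕ) (ε : ℝ) (nbr : Fin N → Finset (Fin N))
    (B : Matrix (Fin N) (Fin K) ℝ) : ℝ :=
  ∑ k : Fin K, ∑ n : Fin N, gradAbs N K ε nbr B n k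

/-- The matrix `P(B)` from the TV surrogate construction. -/
noncomputable def Pmat (N K : ℕ) (ε : ℝ) (nbr : Fin N → Finset (Fin N))
    (B : Matrix (Fin N) (Fin K) ℝ) : Matrix (Fin N) (Fin K) ℝ :=
  fun n k =>
    (1 / gradAbs N K ε nbr B n k) * (∑ _ℓ ∈ nbr n, (1 : ℝ))
      + ∑ ℓ ∈ Finset.univ.filter (fun ℓ => n ∈ nbr ℓ), 1 / gradAbs N K ε nbr B ℓ k

/-- The matrix `Z(B)` from the TV surrogate construction. -/
noncomputable def Zmat (N K : ℕ) (ε : ℝ) (nbr : Fin N → Finset (Fin N))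
    (B : Matrix (Fin N) (Fin K) ℝ) : Matrix (Fin N) (Fin K) ℝ :=
  fun n k =>
    (1 / Pmat N K ε nbr B n k) *
      ((1 / gradAbs N K ε nbr B n k) * (∑ ℓ ∈ nbr n, (B n k + B ℓ k) / 2)
        + ∑ ℓ ∈ Finset.univ.filter (fun ℓ => n ∈ nbr ℓ),
            (B n k + B ℓ k) / (2 * gradAbs N K ε nbr B ℓ k))

/-- The cost function of the NMF model `BC-X`:
`F(B,C,X) = Σ_t ½‖A_tX_{•,t} − Y_{•,t}‖² + (α/2)‖BC − X‖_F² + λ_B‖B‖₁ + (μ_B/2)‖B‖_F²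
  + λ_C‖C‖₁ + (μ_C/2)‖C‖_F² + λ_X‖X‖₁ + (μ_X/2)‖X‖_F² + (τ/2)TV(B)`. -/
noncomputable def costBCX (M N K T : ℕ)
    (A : Fin T → Matrix (Fin M) (Fin N) ℝ) (Y : Matrix (Fin M) (Fin T) ℝ)
    (α lamB muB lamC muC lamX muX τ ε : ℝ) (nbr : Fin N → Finset (Fin N))
    (B : Matrix (Fin N) (Fin K) ℝ) (C : Matrix (Fin K) (Fin T) ℝ)
    (X : Matrix (Fin N) (Fin T) ℝ) : ℝ :=
  (∑ t, (1/2) * ∑ m, ((A t *ᵥ fun n => X n t) m - Y m t) ^ 2)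
    + (α/2) * (∑ n, ∑ t, ((B * C) n t - X n t) ^ 2)
    + lamB * (∑ n, ∑ k, |B n k|) + (muB/2) * (∑ n, ∑ k, (B n k) ^ 2)
    + lamC * (∑ k, ∑ t, |C k t|) + (muC/2) * (∑ k, ∑ t, (C k t) ^ 2)
    + lamX * (∑ n, ∑ t, |X n t|) + (muX/2) * (∑ n, ∑ t, (X n t) ^ 2)
    + (τ/2) * smoothTV N K ε nbr B

/-- A weighted Cauchy–Schwarz inequality with positive weights `x`. -/
lemma sq_sum_mul_le_sum_mul_sum_div {ι : Type*} [Fintype ι] {l x : ι → ℝ}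
    (hl : ∀ i, 0 ≤ l i) (hx : ∀ i, 0 < x i) (δ : ι → ℝ) :
    (∑ i, l i * δ i) ^ 2 ≤ (∑ i, l i * x i) * ∑ i, l i * (δ i ^ 2 / x i) := by
  refine Finset.sum_sq_le_sum_mul_sum_of_sq_le_mul _ (fun i _ => ?_) (fun i _ => ?_)
    (fun i _ => ?_)
  · exact mul_nonneg (hl i) (hx i).le
  · exact mul_nonneg (hl i) (div_nonneg (sq_nonneg _) (hx i).le)
  · have := (hx i).ne'
    exact le_of_eq (by field_simp)

/-- The multiplicative update, characterised by `D ∘ x' = x ∘ (c Lᵀy + q)` with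
`D = c LᵀLx + p ∘ x + s`, does not increase the penalised least squares cost
`(c/2)‖Lx - y‖² + ∑ᵢ (pᵢ/2 xᵢ² + s xᵢ - qᵢ xᵢ)`. -/
lemma multiplicative_update_le {ι J : Type*} [Fintype ι] [Fintype J]
    {L : J → ι → ℝ} (hL : ∀ j i, 0 ≤ L j i) (y : J → ℝ) {c s : ℝ} (hc : 0 ≤ c) (hs : 0 ≤ s)
    {p : ι → ℝ} (hp : ∀ i, 0 ≤ p i) (q : ι → ℝ) {x : ι → ℝ} (hx : ∀ i, 0 < x i) {x' : ι → ℝ}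
    (h : ∀ i, x' i * (c * ∑ j, L j i * ∑ i', L j i' * x i' + p i * x i + s)
      = x i * (c * ∑ j, L j i * y j + q i)) :
    c / 2 * ∑ j, (∑ i, L j i * x' i - y j) ^ 2
        + ∑ i, (p i / 2 * x' i ^ 2 + s * x' i - q i * x' i)
      ≤ c / 2 * ∑ j, (∑ i, L j i * x i - y j) ^ 2
        + ∑ i, (p i / 2 * x i ^ 2 + s * x i - q i * x i) := by
  set δ : ι → ℝ := fun i => x' i - x i with hδ
  set u : ι → ℝ := fun i => ∑ j, L j i * ∑ i', L j i' * x i' with hu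
  set v : ι → ℝ := fun i => ∑ j, L j i * y j with hv
  have hquad : ∑ j, (∑ i, L j i * x' i - y j) ^ 2
      ≤ ∑ j, (∑ i, L j i * x i - y j) ^ 2
        + ∑ i, (2 * (u i - v i) * δ i + u i * (δ i ^ 2 / x i)) := by
    have hswap : ∑ i, (2 * (u i - v i) * δ i + u i * (δ i ^ 2 / x i))
        = ∑ j, (2 * (∑ i, L j i * x i - y j) * ∑ i, L j i * δ i
          + (∑ i, L j i * x i) * ∑ i, L j i * (δ i ^ 2 / x i)) := by
      simp only [hu, hv, Finset.mul_sum (s := (Finset.univ : Finset ι)) (f := fun i => L _ i * δ i),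
        Finset.mul_sum (s := (Finset.univ : Finset ι)) (f := fun i => L _ i * (δ i ^ 2 / x i)),
        ← Finset.sum_add_distrib]
      rw [Finset.sum_comm]
      refine Finset.sum_congr rfl fun i _ => ?_
      rw [← Finset.sum_sub_distrib, Finset.mul_sum, Finset.sum_mul, Finset.sum_mul,
        ← Finset.sum_add_distrib]
      exact Finset.sum_congr rfl fun j _ => by ring
    rw [hswap, ← Finset.sum_add_distrib]
    refine Finset.sum_le_sum fun j _ => ?_
    have hsplit : ∑ i, L j i * x' i = ∑ i, L j i * x i + ∑ i, L j i * δ i := by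
      rw [← Finset.sum_add_distrib]
      exact Finset.sum_congr rfl fun i _ => by simp only [hδ]; ring
    rw [hsplit]
    nlinarith [sq_sum_mul_le_sum_mul_sum_div (hL j) hx δ]
  have hcoord : ∑ i, (p i / 2 * x' i ^ 2 + s * x' i - q i * x' i)
        + c / 2 * ∑ i, (2 * (u i - v i) * δ i + u i * (δ i ^ 2 / x i))
      ≤ ∑ i, (p i / 2 * x i ^ 2 + s * x i - q i * x i) := by
    rw [Finset.mul_sum, ← Finset.sum_add_distrib]
    refine Finset.sum_le_sum fun i _ => ?_
    have hu0 : 0 ≤ u i := Finset.sum_nonneg fun j _ =>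
      mul_nonneg (hL j i) (Finset.sum_nonneg fun i' _ => mul_nonneg (hL j i') (hx i').le)
    have hxi := (hx i).ne'
    obtain ⟨r, hr⟩ : ∃ r, δ i = x i * r := ⟨δ i / x i, by field_simp⟩
    have hx' : x' i = x i + x i * r := by rw [← hr]; simp only [hδ]; ring
    have hi : (1 + r) * (c * u i + p i * x i + s) = c * v i + q i := by
      have := h i
      rw [hx'] at this
      apply mul_left_cancel₀ hxi
      linear_combination this
    have hq : q i = (1 + r) * (c * u i + p i * x i + s) - c * v i := by linarith
    have hdiv : (x i * r) ^ 2 / x i = x i * r ^ 2 := by field_simp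
    rw [hr, hdiv, hx', hq]
    have h1 : 0 ≤ x i * r ^ 2 * (c * u i) :=
      mul_nonneg (mul_nonneg (hx i).le (sq_nonneg _)) (mul_nonneg hc hu0)
    have h2 : 0 ≤ x i * r ^ 2 * s := mul_nonneg (mul_nonneg (hx i).le (sq_nonneg _)) hs
    have h3 : 0 ≤ x i * r ^ 2 * (p i * x i) :=
      mul_nonneg (mul_nonneg (hx i).le (sq_nonneg _)) (mul_nonneg (hp i) (hx i).le)
    linarith
  have := mul_le_mul_of_nonneg_left hquad (by linarith : 0 ≤ c / 2)
  linarith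

section TotalVariation

variable {N K : ℕ} {ε : ℝ} {nbr : Fin N → Finset (Fin N)}

lemma gradAbs_pos (hε : 0 < ε) (B : Matrix (Fin N) (Fin K) ℝ) (n : Fin N) (k : Fin K) :
    0 < gradAbs N K ε nbr B n k :=
  Real.sqrt_pos.2 (add_pos_of_pos_of_nonneg (by positivity)
    (Finset.sum_nonneg fun _ _ => sq_nonneg _))

lemma gradAbs_sq (B : Matrix (Fin N) (Fin K) ℝ) (n : Fin N) (k : Fin K) :
    gradAbs N K ε nbr B n k ^ 2 = ε ^ 2 + ∑ ℓ ∈ nbr n, (B n k - B ℓ k) ^ 2 :=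
  Real.sq_sqrt (add_nonneg (sq_nonneg _) (Finset.sum_nonneg fun _ _ => sq_nonneg _))

lemma Pmat_pos (hε : 0 < ε) (hnbr : ∀ n, (nbr n).Nonempty) (B : Matrix (Fin N) (Fin K) ℝ)
    (n : Fin N) (k : Fin K) : 0 < Pmat N K ε nbr B n k := by
  refine add_pos_of_pos_of_nonneg (mul_pos (one_div_pos.2 (gradAbs_pos hε B n k)) ?_)
    (Finset.sum_nonneg fun ℓ _ => (one_div_pos.2 (gradAbs_pos hε B ℓ k)).le)
  exact Finset.sum_pos (fun _ _ => one_pos) (hnbr n)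

lemma Pmat_mul_Zmat (hε : 0 < ε) (hnbr : ∀ n, (nbr n).Nonempty) (B : Matrix (Fin N) (Fin K) ℝ)
    (n : Fin N) (k : Fin K) :
    Pmat N K ε nbr B n k * Zmat N K ε nbr B n k =
      (1 / gradAbs N K ε nbr B n k) * (∑ ℓ ∈ nbr n, (B n k + B ℓ k) / 2)
        + ∑ ℓ ∈ Finset.univ.filter (fun ℓ => n ∈ nbr ℓ),
            (B n k + B ℓ k) / (2 * gradAbs N K ε nbr B ℓ k) := by
  rw [Zmat, ← mul_assoc, mul_one_div_cancel (Pmat_pos hε hnbr B n k).ne', one_mul]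

lemma Pmat_mul_Zmat_nonneg (hε : 0 < ε) (hnbr : ∀ n, (nbr n).Nonempty)
    {B : Matrix (Fin N) (Fin K) ℝ} (hB : ∀ n k, 0 < B n k) (n : Fin N) (k : Fin K) :
    0 ≤ Pmat N K ε nbr B n k * Zmat N K ε nbr B n k := by
  rw [Pmat_mul_Zmat hε hnbr]
  refine add_nonneg (mul_nonneg (one_div_pos.2 (gradAbs_pos hε B n k)).le
    (Finset.sum_nonneg fun ℓ _ => ?_)) (Finset.sum_nonneg fun ℓ _ => ?_)
  · linarith [hB n k, hB ℓ k]
  · exact div_nonneg (add_pos (hB n k) (hB ℓ k)).le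
      (mul_pos two_pos (gradAbs_pos hε B ℓ k)).le

/-- The separable quadratic surrogate of the total variation. -/
lemma smoothTV_sub_le (hε : 0 < ε) (hnbr : ∀ n, (nbr n).Nonempty)
    (B B' : Matrix (Fin N) (Fin K) ℝ) :
    smoothTV N K ε nbr B' - smoothTV N K ε nbr B ≤
      ∑ n, ∑ k, (Pmat N K ε nbr B n k * (B' n k ^ 2 - B n k ^ 2)
        - 2 * (Pmat N K ε nbr B n k * Zmat N K ε nbr B n k) * (B' n k - B n k)) := by
  rw [Finset.sum_comm, smoothTV, smoothTV, ← Finset.sum_sub_distrib]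
  refine Finset.sum_le_sum fun k _ => ?_
  set w : Fin N → ℝ := fun n => 1 / gradAbs N K ε nbr B n k with hw
  set f : Fin N → Fin N → ℝ := fun n ℓ =>
    (B' n k ^ 2 - B n k ^ 2) - (B n k + B ℓ k) * (B' n k - B n k) with hf
  have hstep : ∀ n, gradAbs N K ε nbr B' n k - gradAbs N K ε nbr B n k ≤
      ∑ ℓ ∈ nbr n, w n * f n ℓ + ∑ ℓ ∈ nbr n, w n * f ℓ n := by
    intro n
    have hg := gradAbs_pos (nbr := nbr) hε B n k
    have hsum : ∑ ℓ ∈ nbr n, (B' n k - B' ℓ k) ^ 2 - ∑ ℓ ∈ nbr n, (B n k - B ℓ k) ^ 2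
        ≤ 2 * (∑ ℓ ∈ nbr n, f n ℓ + ∑ ℓ ∈ nbr n, f ℓ n) := by
      rw [← Finset.sum_sub_distrib, ← Finset.sum_add_distrib, Finset.mul_sum]
      refine Finset.sum_le_sum fun ℓ _ => ?_
      simp only [hf]
      nlinarith [sq_nonneg (B' n k + B' ℓ k - B n k - B ℓ k)]
    rw [← Finset.mul_sum, ← Finset.mul_sum, ← mul_add, hw]
    simp only [one_div_mul_eq_div]
    rw [le_div_iff₀ hg]
    nlinarith [gradAbs_sq (ε := ε) (nbr := nbr) B n k, gradAbs_sq (ε := ε) (nbr := nbr) B' n k,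
      sq_nonneg (gradAbs N K ε nbr B' n k - gradAbs N K ε nbr B n k)]
  have hcomm : ∑ n, ∑ ℓ ∈ nbr n, w n * f ℓ n
      = ∑ n, ∑ ℓ ∈ Finset.univ.filter (fun ℓ => n ∈ nbr ℓ), w ℓ * f n ℓ :=
    Finset.sum_comm' fun n ℓ => by simp
  rw [← Finset.sum_sub_distrib]
  refine (Finset.sum_le_sum fun n _ => hstep n).trans (le_of_eq ?_)
  rw [Finset.sum_add_distrib, hcomm, ← Finset.sum_add_distrib]
  refine Finset.sum_congr rfl fun n _ => ?_
  rw [Pmat_mul_Zmat hε hnbr, Pmat]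
  have h1 : ∑ ℓ ∈ nbr n, w n * f n ℓ = w n * (∑ _ℓ ∈ nbr n, (1 : ℝ)) * (B' n k ^ 2 - B n k ^ 2)
      - 2 * (w n * ∑ ℓ ∈ nbr n, (B n k + B ℓ k) / 2) * (B' n k - B n k) := by
    simp only [Finset.mul_sum, Finset.sum_mul, ← Finset.sum_sub_distrib]
    exact Finset.sum_congr rfl fun ℓ _ => by simp only [hf]; ring
  have h2 : ∑ ℓ ∈ Finset.univ.filter (fun ℓ => n ∈ nbr ℓ), w ℓ * f n ℓ
      = (∑ ℓ ∈ Finset.univ.filter (fun ℓ => n ∈ nbr ℓ), w ℓ) * (B' n k ^ 2 - B n k ^ 2)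
      - 2 * (∑ ℓ ∈ Finset.univ.filter (fun ℓ => n ∈ nbr ℓ),
            (B n k + B ℓ k) / (2 * gradAbs N K ε nbr B ℓ k)) * (B' n k - B n k) := by
    simp only [Finset.mul_sum, Finset.sum_mul, ← Finset.sum_sub_distrib]
    refine Finset.sum_congr rfl fun ℓ _ => ?_
    have hg := (gradAbs_pos (nbr := nbr) hε B ℓ k).ne'
    simp only [hf, hw]
    field_simp
  rw [h1, h2]
  ring

end TotalVariation

section Cost

variable {M N K T : ℕ} {ε : ℝ} {nbr : Fin N → Finset (Fin N)}
  {A : Fin T → Matrix (Fin M) (Fin N) ℝ} {Y : Matrix (Fin M) (Fin T) ℝ}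
  {α lamB muB lamC muC lamX muX τ : ℝ}
  {X : Matrix (Fin N) (Fin T) ℝ} {B : Matrix (Fin N) (Fin K) ℝ} {C : Matrix (Fin K) (Fin T) ℝ}

/-- The multiplicative update of `X` does not increase the cost. -/
lemma costBCX_update_X_le (hA : ∀ t m n, 0 ≤ A t m n) (hα : 0 < α) (hlamX : 0 ≤ lamX)
    (hmuX : 0 ≤ muX) (hX : ∀ n t, 0 < X n t) {X' : Matrix (Fin N) (Fin T) ℝ}
    (hX'0 : ∀ n t, 0 ≤ X' n t)
    (hX' : ∀ n t, X' n t *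
        ((((A t)ᵀ * A t) *ᵥ fun n' => X n' t) n + (muX + α) * X n t + lamX)
      = X n t * (((A t)ᵀ *ᵥ fun m => Y m t) n + α * (B * C) n t)) :
    costBCX M N K T A Y α lamB muB lamC muC lamX muX τ ε nbr B C X'
      ≤ costBCX M N K T A Y α lamB muB lamC muC lamX muX τ ε nbr B C X := by
  have key : ∀ t, _ := fun t => multiplicative_update_le (L := A t) (hA t) (fun m => Y m t)
    (c := 1) zero_le_one hlamX (p := fun _ => muX + α) (fun _ => by positivity)
    (fun n => α * (B * C) n t) (x := fun n => X n t) (fun n => hX n t) (x' := fun n => X' n t)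
    (fun n => by
      have h := hX' n t
      rw [← mulVec_mulVec] at h
      simpa only [mulVec, dotProduct, transpose_apply, one_mul] using h)
  have hsum := Finset.sum_le_sum fun t (_ : t ∈ Finset.univ) => key t
  have expand : ∀ V : Matrix (Fin N) (Fin T) ℝ, (∀ n t, 0 ≤ V n t) →
      (∑ t, (1/2) * ∑ m, ((A t *ᵥ fun n => V n t) m - Y m t) ^ 2)
        + (α/2) * (∑ n, ∑ t, ((B * C) n t - V n t) ^ 2)
        + lamX * (∑ n, ∑ t, |V n t|) + (muX/2) * (∑ n, ∑ t, (V n t) ^ 2)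
      = ∑ t, (1 / 2 * ∑ m, (∑ n, A t m n * V n t - Y m t) ^ 2
          + ∑ n, ((muX + α) / 2 * V n t ^ 2 + lamX * V n t - α * (B * C) n t * V n t))
        + (α/2) * ∑ t, ∑ n, (B * C) n t ^ 2 := by
    intro V hV
    simp only [abs_of_nonneg (hV _ _)]
    rw [Finset.sum_comm (f := fun n t => ((B * C) n t - V n t) ^ 2),
      Finset.sum_comm (f := fun n t => V n t), Finset.sum_comm (f := fun n t => V n t ^ 2)]
    simp only [Finset.mul_sum (s := (Finset.univ : Finset (Fin T))), ← Finset.sum_add_distrib]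
    refine Finset.sum_congr rfl fun t _ => ?_
    simp only [mulVec, dotProduct, add_assoc, add_right_inj]
    simp only [Finset.mul_sum, ← Finset.sum_add_distrib]
    exact Finset.sum_congr rfl fun n _ => by ring
  have e1 := expand X' hX'0
  have e2 := expand X fun n t => (hX n t).le
  unfold costBCX
  linarith

/-- The multiplicative update of `B` does not increase the cost. -/
lemma costBCX_update_B_le (hε : 0 < ε) (hnbr : ∀ n, (nbr n).Nonempty) (hα : 0 < α)
    (hlamB : 0 ≤ lamB) (hmuB : 0 ≤ muB) (hτ : 0 ≤ τ) (hB : ∀ n k, 0 < B n k)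
    (hC : ∀ k t, 0 ≤ C k t) {B' : Matrix (Fin N) (Fin K) ℝ} (hB'0 : ∀ n k, 0 ≤ B' n k)
    (hB' : ∀ n k, B' n k * (α * (B * C * Cᵀ) n k + muB * B n k + lamB
            + τ * B n k * Pmat N K ε nbr B n k)
      = B n k * (α * (X * Cᵀ) n k + τ * Pmat N K ε nbr B n k * Zmat N K ε nbr B n k)) :
    costBCX M N K T A Y α lamB muB lamC muC lamX muX τ ε nbr B' C X
      ≤ costBCX M N K T A Y α lamB muB lamC muC lamX muX τ ε nbr B C X := by
  have key : ∀ n, _ := fun n => multiplicative_update_le (L := fun t k => C k t)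
    (fun t k => hC k t) (fun t => X n t) hα.le hlamB
    (p := fun k => muB + τ * Pmat N K ε nbr B n k)
    (fun k => add_nonneg hmuB (mul_nonneg hτ (Pmat_pos hε hnbr B n k).le))
    (fun k => τ * Pmat N K ε nbr B n k * Zmat N K ε nbr B n k)
    (x := B n) (hB n) (x' := B' n)
    (fun k => by
      have h := hB' n k
      have e1 : (B * C * Cᵀ) n k = ∑ t, C k t * ∑ k', C k' t * B n k' := by
        simp only [mul_apply, transpose_apply, mul_comm]
      have e2 : (X * Cᵀ) n k = ∑ t, C k t * X n t := by
        simp only [mul_apply, transpose_apply, mul_comm]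
      rw [e1, e2] at h
      linear_combination h)
  have hsum := Finset.sum_le_sum fun n (_ : n ∈ Finset.univ) => key n
  have htv := mul_le_mul_of_nonneg_left (smoothTV_sub_le hε hnbr B B')
    (by linarith : 0 ≤ τ / 2)
  have expand : ∀ V : Matrix (Fin N) (Fin K) ℝ, (∀ n k, 0 ≤ V n k) →
      (α/2) * (∑ n, ∑ t, ((V * C) n t - X n t) ^ 2)
        + lamB * (∑ n, ∑ k, |V n k|) + (muB/2) * (∑ n, ∑ k, (V n k) ^ 2)
        + (τ/2) * (∑ n, ∑ k, (Pmat N K ε nbr B n k * V n k ^ 2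
            - 2 * (Pmat N K ε nbr B n k * Zmat N K ε nbr B n k) * V n k))
      = ∑ n, (α / 2 * ∑ t, (∑ k, C k t * V n k - X n t) ^ 2
          + ∑ k, ((muB + τ * Pmat N K ε nbr B n k) / 2 * V n k ^ 2 + lamB * V n k
            - τ * Pmat N K ε nbr B n k * Zmat N K ε nbr B n k * V n k)) := by
    intro V hV
    simp only [abs_of_nonneg (hV _ _)]
    simp only [Finset.mul_sum (s := (Finset.univ : Finset (Fin N))), ← Finset.sum_add_distrib]
    refine Finset.sum_congr rfl fun n _ => ?_
    simp only [mul_apply, mul_comm (V _ _) (C _ _), add_assoc, add_right_inj]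
    simp only [Finset.mul_sum, ← Finset.sum_add_distrib]
    exact Finset.sum_congr rfl fun k _ => by ring
  have e1 := expand B' hB'0
  have e2 := expand B fun n k => (hB n k).le
  have hsub : ∑ n, ∑ k, (Pmat N K ε nbr B n k * (B' n k ^ 2 - B n k ^ 2)
        - 2 * (Pmat N K ε nbr B n k * Zmat N K ε nbr B n k) * (B' n k - B n k))
      = ∑ n, ∑ k, (Pmat N K ε nbr B n k * B' n k ^ 2
            - 2 * (Pmat N K ε nbr B n k * Zmat N K ε nbr B n k) * B' n k)
        - ∑ n, ∑ k, (Pmat N K ε nbr B n k * B n k ^ 2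
            - 2 * (Pmat N K ε nbr B n k * Zmat N K ε nbr B n k) * B n k) := by
    simp only [← Finset.sum_sub_distrib]
    exact Finset.sum_congr rfl fun n _ => Finset.sum_congr rfl fun k _ => by ring
  rw [hsub] at htv
  unfold costBCX
  linarith

/-- The multiplicative update of `C` does not increase the cost. -/
lemma costBCX_update_C_le (hα : 0 < α) (hlamC : 0 ≤ lamC) (hmuC : 0 ≤ muC)
    (hB : ∀ n k, 0 ≤ B n k) (hC : ∀ k t, 0 < C k t) {C' : Matrix (Fin K) (Fin T) ℝ}
    (hC'0 : ∀ k t, 0 ≤ C' k t)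
    (hC' : ∀ k t, C' k t * (α * (Bᵀ * B * C) k t + muC * C k t + lamC)
      = C k t * (α * (Bᵀ * X) k t)) :
    costBCX M N K T A Y α lamB muB lamC muC lamX muX τ ε nbr B C' X
      ≤ costBCX M N K T A Y α lamB muB lamC muC lamX muX τ ε nbr B C X := by
  have key : ∀ t, _ := fun t => multiplicative_update_le (L := B)
    hB (fun n => X n t) hα.le hlamC (p := fun _ => muC) (fun _ => hmuC) 0
    (x := fun k => C k t) (fun k => hC k t) (x' := fun k => C' k t)
    (fun k => by
      have h := hC' k t
      rw [Matrix.mul_assoc] at h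
      simpa only [mul_apply, transpose_apply, Pi.zero_apply, add_zero] using h)
  have hsum := Finset.sum_le_sum fun t (_ : t ∈ Finset.univ) => key t
  have expand : ∀ V : Matrix (Fin K) (Fin T) ℝ, (∀ k t, 0 ≤ V k t) →
      (α/2) * (∑ n, ∑ t, ((B * V) n t - X n t) ^ 2)
        + lamC * (∑ k, ∑ t, |V k t|) + (muC/2) * (∑ k, ∑ t, (V k t) ^ 2)
      = ∑ t, (α / 2 * ∑ n, (∑ k, B n k * V k t - X n t) ^ 2
          + ∑ k, (muC / 2 * V k t ^ 2 + lamC * V k t - (0 : Fin K → ℝ) k * V k t)) := by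
    intro V hV
    simp only [abs_of_nonneg (hV _ _)]
    rw [Finset.sum_comm (f := fun n t => ((B * V) n t - X n t) ^ 2),
      Finset.sum_comm (f := fun k t => V k t), Finset.sum_comm (f := fun k t => V k t ^ 2)]
    simp only [Finset.mul_sum (s := (Finset.univ : Finset (Fin T))), ← Finset.sum_add_distrib]
    refine Finset.sum_congr rfl fun t _ => ?_
    simp only [mul_apply, add_assoc, add_right_inj]
    simp only [Finset.mul_sum, ← Finset.sum_add_distrib]
    exact Finset.sum_congr rfl fun k _ => by simp only [Pi.zero_apply]; ring
  have e1 := expand C' hC'0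
  have e2 := expand C fun k t => (hC k t).le
  unfold costBCX
  linarith

end Cost

lemma mul_nonneg_apply {l m n : ℕ} {U : Matrix (Fin l) (Fin m) ℝ} {V : Matrix (Fin m) (Fin n) ℝ}
    (hU : ∀ i j, 0 ≤ U i j) (hV : ∀ i j, 0 ≤ V i j) (i : Fin l) (j : Fin n) :
    0 ≤ (U * V) i j := by
  rw [mul_apply]
  exact Finset.sum_nonneg fun _ _ => mul_nonneg (hU _ _) (hV _ _)

lemma mulVec_nonneg_apply {m n : ℕ} {U : Matrix (Fin m) (Fin n) ℝ} {v : Fin n → ℝ}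
    (hU : ∀ i j, 0 ≤ U i j) (hv : ∀ j, 0 ≤ v j) (i : Fin m) : 0 ≤ (U *ᵥ v) i := by
  rw [mulVec, dotProduct]
  exact Finset.sum_nonneg fun _ _ => mul_nonneg (hU _ _) (hv _)

/-- **Algorithm for model `BC-X` (Theorem 2.2 of the paper).**
The sequential multiplicative updates for `X`, `B` and `C` lead to a monotonic decrease
of the `BC-X` cost function. -/
theorem BCX_update_decreases_cost
    (M N K T : ℕ)
    (ε : ℝ) (hε : 0 < ε)
    (nbr : Fin N → Finset (Fin N)) (hnbr : ∀ n, (nbr n).Nonempty)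
    (A : Fin T → Matrix (Fin M) (Fin N) ℝ) (hA : ∀ t m n, 0 ≤ A t m n)
    (Y : Matrix (Fin M) (Fin T) ℝ) (hY : ∀ m t, 0 ≤ Y m t)
    (α lamB muB lamC muC lamX muX τ : ℝ)
    (hα : 0 < α) (hlamB : 0 ≤ lamB) (hmuB : 0 ≤ muB) (hlamC : 0 ≤ lamC)
    (hmuC : 0 ≤ muC) (hlamX : 0 ≤ lamX) (hmuX : 0 ≤ muX) (hτ : 0 ≤ τ)
    (X : Matrix (Fin N) (Fin T) ℝ) (hX : ∀ n t, 0 < X n t)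
    (B : Matrix (Fin N) (Fin K) ℝ) (hB : ∀ n k, 0 < B n k)
    (C : Matrix (Fin K) (Fin T) ℝ) (hC : ∀ k t, 0 < C k t)
    (Xp : Matrix (Fin N) (Fin T) ℝ)
    (hXp : ∀ n t, Xp n t =
      X n t * (((A t)ᵀ *ᵥ fun m => Y m t) n + α * (B * C) n t)
        / ((((A t)ᵀ * A t) *ᵥ fun n' => X n' t) n + (muX + α) * X n t + lamX))
    (Bp : Matrix (Fin N) (Fin K) ℝ)
    (hBp : ∀ n k, Bp n k =
      B n k * (α * (Xp * Cᵀ) n k + τ * Pmat N K ε nbr B n k * Zmat N K ε nbr B n k)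
        / (α * (B * C * Cᵀ) n k + muB * B n k + lamB
            + τ * B n k * Pmat N K ε nbr B n k))
    (Cp : Matrix (Fin K) (Fin T) ℝ)
    (hCp : ∀ k t, Cp k t =
      C k t * (α * (Bpᵀ * Xp) k t)
        / (α * (Bpᵀ * Bp * C) k t + muC * C k t + lamC)) :
    costBCX M N K T A Y α lamB muB lamC muC lamX muX τ ε nbr Bp Cp Xp
      ≤ costBCX M N K T A Y α lamB muB lamC muC lamX muX τ ε nbr B C X := by
  have hBC : ∀ n t, 0 ≤ (B * C) n t :=
    mul_nonneg_apply (fun n k => (hB n k).le) fun k t => (hC k t).le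
  have hCT : ∀ t k, 0 ≤ Cᵀ t k := fun t k => (hC k t).le
  have hXden : ∀ n t,
      0 < (((A t)ᵀ * A t) *ᵥ fun n' => X n' t) n + (muX + α) * X n t + lamX := fun n t => by
    have h1 : 0 ≤ (((A t)ᵀ * A t) *ᵥ fun n' => X n' t) n :=
      mulVec_nonneg_apply (mul_nonneg_apply (fun i j => hA t j i) (hA t))
        (fun n' => (hX n' t).le) n
    have h2 : 0 < (muX + α) * X n t := mul_pos (by linarith) (hX n t)
    linarith
  have hXp0 : ∀ n t, 0 ≤ Xp n t := fun n t => by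
    have h1 : 0 ≤ ((A t)ᵀ *ᵥ fun m => Y m t) n :=
      mulVec_nonneg_apply (fun i j => hA t j i) (fun m => hY m t) n
    rw [hXp]
    exact div_nonneg (mul_nonneg (hX n t).le
      (add_nonneg h1 (mul_nonneg hα.le (hBC n t)))) (hXden n t).le
  have hP := Pmat_pos (nbr := nbr) hε hnbr B
  have hBCC : ∀ n k, 0 ≤ (B * C * Cᵀ) n k := mul_nonneg_apply hBC hCT
  have hBnum : ∀ n k,
      0 ≤ α * (Xp * Cᵀ) n k + τ * Pmat N K ε nbr B n k * Zmat N K ε nbr B n k := fun n k => by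
    have := Pmat_mul_Zmat_nonneg (nbr := nbr) hε hnbr hB n k
    rw [mul_assoc τ]
    exact add_nonneg (mul_nonneg hα.le (mul_nonneg_apply hXp0 hCT n k)) (mul_nonneg hτ this)
  have hBden : ∀ n k, 0 ≤ τ * B n k * Pmat N K ε nbr B n k := fun n k =>
    mul_nonneg (mul_nonneg hτ (hB n k).le) (hP n k).le
  have hBp0 : ∀ n k, 0 ≤ Bp n k := fun n k => by
    rw [hBp]
    refine div_nonneg (mul_nonneg (hB n k).le (hBnum n k)) ?_
    have h1 := mul_nonneg hα.le (hBCC n k)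
    have h2 := mul_nonneg hmuB (hB n k).le
    linarith [hBden n k]
  have hBpT : ∀ k n, 0 ≤ Bpᵀ k n := fun k n => hBp0 n k
  have hBpBp : ∀ k t, 0 ≤ (Bpᵀ * Bp * C) k t :=
    mul_nonneg_apply (mul_nonneg_apply hBpT hBp0) fun k t => (hC k t).le
  have hCp0 : ∀ k t, 0 ≤ Cp k t := fun k t => by
    rw [hCp]
    exact div_nonneg
      (mul_nonneg (hC k t).le (mul_nonneg hα.le (mul_nonneg_apply hBpT hXp0 k t)))
      (add_nonneg (add_nonneg (mul_nonneg hα.le (hBpBp k t))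
        (mul_nonneg hmuC (hC k t).le)) hlamC)
  refine (costBCX_update_C_le hα hlamC hmuC hBp0 hC hCp0 fun k t => ?_).trans
    ((costBCX_update_B_le hε hnbr hα hlamB hmuB hτ hB (fun k t => (hC k t).le) hBp0
      fun n k => ?_).trans
    (costBCX_update_X_le hA hα hlamX hmuX hX hXp0 fun n t => ?_))
  · rw [hCp]
    refine div_mul_cancel_of_imp fun h0 => ?_
    have h1 := mul_nonneg hα.le (hBpBp k t)
    have h2 := mul_nonneg hmuC (hC k t).le
    have h3 : (Bpᵀ * Bp * C) k t = 0 := by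
      have : α * (Bpᵀ * Bp * C) k t = 0 := by linarith
      exact (mul_eq_zero.1 this).resolve_left hα.ne'
    rw [mul_apply, Finset.sum_eq_zero_iff_of_nonneg fun k' _ =>
      mul_nonneg (mul_nonneg_apply hBpT hBp0 k k') (hC k' t).le] at h3
    have h4 := (mul_eq_zero.1 (h3 k (Finset.mem_univ k))).resolve_right (hC k t).ne'
    rw [mul_apply, Finset.sum_eq_zero_iff_of_nonneg fun n _ =>
      mul_nonneg (hBpT k n) (hBp0 n k)] at h4
    have h5 : (Bpᵀ * Xp) k t = 0 := by
      rw [mul_apply]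
      refine Finset.sum_eq_zero fun n hn => ?_
      rw [mul_self_eq_zero.1 (h4 n hn), zero_mul]
    simp [h5]
  · rw [hBp]
    refine div_mul_cancel_of_imp fun h0 => ?_
    have h1 := mul_nonneg hα.le (hBCC n k)
    have h2 := mul_nonneg hmuB (hB n k).le
    have hτ0 : τ = 0 := by
      have : τ * B n k * Pmat N K ε nbr B n k = 0 := by linarith [hBden n k]
      simpa [(hB n k).ne', (hP n k).ne'] using this
    have h3 : (B * C * Cᵀ) n k = 0 := by
      have : α * (B * C * Cᵀ) n k = 0 := by linarith [hBden n k]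
      exact (mul_eq_zero.1 this).resolve_left hα.ne'
    rw [mul_apply, Finset.sum_eq_zero_iff_of_nonneg fun t _ =>
      mul_nonneg (hBC n t) (hCT t k)] at h3
    have h5 : (Xp * Cᵀ) n k = 0 := by
      rw [mul_apply]
      refine Finset.sum_eq_zero fun t ht => ?_
      have hpos : 0 < (B * C) n t := by
        rw [mul_apply]
        exact Finset.sum_pos (fun k' _ => mul_pos (hB n k') (hC k' t)) ⟨k, Finset.mem_univ k⟩
      exact absurd (h3 t ht) (mul_pos hpos (hC k t)).ne'
    simp [h5, hτ0]
  · rw [hXp]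
    exact div_mul_cancel₀ _ (hXden n t).ne'
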